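/- Let (W,S) be a Coxeter system, J ⊆ S a subset, and k ∈ S \ J an index such that the simple reflection s_k commutes with s_j for every j ∈ J (equivalently, the Coxeter matrix entry m(k,j) = 2 for all j ∈ J). If w ∈ W is a minimal-length coset representative for W/W_J (that is, ℓ(w u) ≥ ℓ(w) for every u ∈ W_J), then w s_k is also a minimal-length coset representative for W/W_J (that is, ℓ(w s_k u) ≥ ℓ(w s_k) for every u ∈ W_J). Consequently both w_k and w^k are minimal-length coset representatives. [This is the Coxeter-theoretic form of Lemma 2.2: for a k-free parabolic subgroup P of a simple Lie group G, if w ∈ W^P then w_k, w^k ∈ W^P.] -/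

import Mathlib

namespace CoxeterSystem

open Polynomial.Chebyshev in
/-- The coefficients in `Module.reflection_mul_reflection_pow` vanish at
`t = 2 * cos (2 * π / m)`. -/
theorem chebyshev_S_coeff_eq_zero {m : ℕ} (hm : 3 ≤ m) {t : ℝ}
    (ht : t = 2 * Real.cos (2 * Real.pi / m)) :
    (S ℝ ((m - 2 : ℤ) / 2)).eval t *
        ((S ℝ ((m - 1 : ℤ) / 2)).eval t + (S ℝ ((m - 3 : ℤ) / 2)).eval t) = 0 ∧
      (S ℝ ((m - 1 : ℤ) / 2)).eval t *
        ((S ℝ ((m : ℤ) / 2)).eval t + (S ℝ ((m - 2 : ℤ) / 2)).eval t) = 0 := by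
  have hm' : (3 : ℝ) ≤ m := by exact_mod_cast hm
  set θ : ℝ := 2 * Real.pi / m with hθ
  have hmθ : (m : ℝ) * θ = 2 * Real.pi := by rw [hθ]; field_simp
  have hpi := Real.pi_pos
  have hsin : Real.sin θ ≠ 0 := by
    refine (Real.sin_pos_of_pos_of_lt_pi (by positivity) ?_).ne'
    rw [hθ, div_lt_iff₀ (by linarith)]
    nlinarith
  rcases Nat.even_or_odd' m with ⟨k, rfl | rfl⟩
  · have hS : (S ℝ ((k : ℤ) - 1)).eval t = 0 := by
      refine (mul_eq_zero.mp ?_).resolve_right hsin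
      rw [ht, S_two_mul_real_cos]
      push_cast at hmθ ⊢
      rw [show ((k : ℝ) - 1 + 1) * θ = Real.pi by linarith, Real.sin_pi]
    rw [show (((2 * k : ℕ) : ℤ) - 2) / 2 = k - 1 by omega,
      show (((2 * k : ℕ) : ℤ) - 1) / 2 = k - 1 by omega, hS]
    simp
  · have hS : (S ℝ (k : ℤ)).eval t + (S ℝ ((k : ℤ) - 1)).eval t = 0 := by
      refine (mul_eq_zero.mp ?_).resolve_right hsin
      rw [ht, add_mul, S_two_mul_real_cos, S_two_mul_real_cos]
      push_cast at hmθ ⊢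
      rw [show ((k : ℝ) + 1) * θ = 2 * Real.pi - ((k : ℝ) - 1 + 1) * θ by linarith,
        Real.sin_two_pi_sub, neg_add_cancel]
    rw [show (((2 * k + 1 : ℕ) : ℤ) - 2) / 2 = k - 1 by omega,
      show (((2 * k + 1 : ℕ) : ℤ) - 1) / 2 = k by omega,
      show (((2 * k + 1 : ℕ) : ℤ) - 3) / 2 = k - 1 by omega,
      show ((2 * k + 1 : ℕ) : ℤ) / 2 = k by omega, hS]
    simp

variable {B W : Type*} [Group W] {M : CoxeterMatrix B}

/-- The coroot of `i` in the geometric representation on `B →₀ ℝ`. -/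
noncomputable def geometricCoroot (M : CoxeterMatrix B) (i : B) :
    Module.Dual ℝ (B →₀ ℝ) :=
  Finsupp.linearCombination ℝ fun j ↦ -2 * Real.cos (Real.pi / M i j)

theorem geometricCoroot_single (M : CoxeterMatrix B) (i j : B) :
    geometricCoroot M i (Finsupp.single j 1) = -2 * Real.cos (Real.pi / M i j) := by
  simp [geometricCoroot]

theorem geometricCoroot_single_self (M : CoxeterMatrix B) (i : B) :
    geometricCoroot M i (Finsupp.single i 1) = 2 := by
  simp [geometricCoroot_single]

/-- The reflection by which `s i` acts in the geometric representation. -/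
noncomputable def geometricReflection (M : CoxeterMatrix B) (i : B) :
    (B →₀ ℝ) ≃ₗ[ℝ] (B →₀ ℝ) :=
  Module.reflection (geometricCoroot_single_self M i)

theorem isLiftable_geometricReflection (M : CoxeterMatrix B) :
    M.IsLiftable (geometricReflection M) := by
  intro i j
  by_cases hij : i = j
  · subst hij
    rw [M.diagonal, pow_one]
    ext1 v
    exact Module.involutive_reflection (geometricCoroot_single_self M i) v
  have h1 : M i j ≠ 1 := M.off_diagonal i j hij
  have hform := geometricCoroot_single M i j
  have hform' := geometricCoroot_single M j i
  rw [M.symmetric j i] at hform'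
  apply LinearEquiv.toLinearMap_injective
  rw [geometricReflection, geometricReflection, Module.reflection_mul_reflection_pow]
  obtain h0 | h2 | h3 : M i j = 0 ∨ M i j = 2 ∨ 3 ≤ M i j := by omega
  · simp [h0]
  · rw [hform, hform']
    refine LinearMap.ext fun v ↦ ?_
    simp [h2]
    module
  · have ht : geometricCoroot M i (Finsupp.single j 1) * geometricCoroot M j (Finsupp.single i 1)
        - 2 = 2 * Real.cos (2 * Real.pi / M i j) := by
      rw [hform, hform', mul_div_assoc, Real.cos_two_mul]
      ring
    obtain ⟨ha, hb⟩ := chebyshev_S_coeff_eq_zero h3 ht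
    rw [ha, hb, zero_smul, zero_smul, add_zero, add_zero]
    rfl

theorem simple_injective (cs : CoxeterSystem M W) : Function.Injective cs.simple := by
  intro i j h
  by_contra hij
  have h' := congrArg (cs.lift ⟨_, isLiftable_geometricReflection M⟩) h
  rw [lift_apply_simple, lift_apply_simple] at h'
  have h'' := DFunLike.congr_fun (LinearEquiv.congr_fun h' (Finsupp.single i 1)) i
  simp [geometricReflection, Module.reflection_apply, geometricCoroot_single, hij] at h''
  norm_num at h''

theorem commute_simple (cs : CoxeterSystem M W) {i j : B} (h : M i j = 2) :
    Commute (cs.simple i) (cs.simple j) := by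
  have h' := cs.simple_mul_simple_pow i j
  rw [h, pow_two, mul_eq_one_iff_eq_inv, mul_inv_rev, inv_simple, inv_simple] at h'
  exact h'

theorem functionEnd_mul_apply {α : Type*} (f g : Function.End α) (a : α) :
    (f * g) a = f (g a) :=
  rfl

open scoped Classical in
/-- The action of `s i` on `W × ZMod 2` which conjugates the first coordinate, and changes the second
coordinate exactly when the first is `s i`. -/
noncomputable def signedConj (cs : CoxeterSystem M W) (i : B) :
    Function.End (W × ZMod 2) :=
  fun p ↦ (cs.simple i * p.1 * cs.simple i, p.2 + if p.1 = cs.simple i then 1 else 0)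

open scoped Classical in
theorem signedConj_mul_pow_apply (cs : CoxeterSystem M W) (i j : B) (n : ℕ) (t : W)
    (z : ZMod 2) :
    ((cs.signedConj i * cs.signedConj j) ^ n : Function.End (W × ZMod 2)) (t, z) =
      ((cs.simple i * cs.simple j) ^ n * t * ((cs.simple i * cs.simple j) ^ n)⁻¹,
        z + ∑ l ∈ Finset.range (2 * n),
          if t = cs.simple j * (cs.simple i * cs.simple j) ^ l then 1 else 0) := by
  induction n with
  | zero => simp [Function.End.one_def]
  | succ n ih =>
    set r := cs.simple i * cs.simple j with hr
    have hinv : SemiconjBy (cs.simple j) r r⁻¹ := by simp [SemiconjBy, hr, mul_assoc]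
    have hinv_pow (l : ℕ) : cs.simple j * r ^ l = (r ^ l)⁻¹ * cs.simple j := by
      rw [← inv_pow]
      exact (hinv.pow_right l).eq
    have h1 : r ^ n * t * (r ^ n)⁻¹ = cs.simple j ↔ t = cs.simple j * r ^ (2 * n) := by
      rw [two_mul, pow_add, ← mul_assoc, hinv_pow, mul_inv_eq_iff_eq_mul, mul_assoc,
        ← eq_inv_mul_iff_mul_eq]
    have h2 : cs.simple j * (r ^ n * t * (r ^ n)⁻¹) * cs.simple j = cs.simple i ↔
        t = cs.simple j * r ^ (2 * n + 1) := by
      have h3 (x : W) : cs.simple j * x * cs.simple j = cs.simple i ↔ x = cs.simple j * r := by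
        rw [← eq_mul_inv_iff_mul_eq, ← eq_inv_mul_iff_mul_eq, inv_simple]
      rw [h3, mul_inv_eq_iff_eq_mul, mul_assoc, ← eq_inv_mul_iff_mul_eq, ← mul_assoc,
        ← hinv_pow, mul_assoc, ← pow_succ', ← pow_add, two_mul, add_assoc]
    rw [pow_succ', show 2 * (n + 1) = 2 * n + 1 + 1 by ring, Finset.sum_range_succ,
      Finset.sum_range_succ]
    rw [functionEnd_mul_apply, functionEnd_mul_apply, ih]
    simp only [signedConj, h1, h2, Prod.mk.injEq, add_assoc, and_true]
    rw [pow_succ' r n, mul_inv_rev, hr]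
    simp [mul_assoc]

theorem isLiftable_signedConj (cs : CoxeterSystem M W) :
    M.IsLiftable cs.signedConj := by
  classical
  intro i j
  funext ⟨t, z⟩
  rw [signedConj_mul_pow_apply, two_mul, Finset.sum_range_add]
  simp [pow_add, CharTwo.add_self_eq_zero, Function.End.one_def]

/-- The parity of the multiplicity of `t` in the right inversion sequence of any word for `w`. -/
noncomputable def inversionParity (cs : CoxeterSystem M W) (w t : W) : ZMod 2 :=
  (cs.lift ⟨_, cs.isLiftable_signedConj⟩ w (t, 0)).2

theorem lift_signedConj_apply (cs : CoxeterSystem M W) (w t : W) (z : ZMod 2) :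
    cs.lift ⟨_, cs.isLiftable_signedConj⟩ w (t, z) =
      (w * t * w⁻¹, z + cs.inversionParity w t) := by
  unfold inversionParity
  induction w using cs.simple_induction_left generalizing t z with
  | one => simp [Function.End.one_def]
  | mul_simple_left w i ih =>
    rw [map_mul, lift_apply_simple]
    rw [functionEnd_mul_apply, functionEnd_mul_apply, ih t z, ih t 0]
    simp [signedConj, mul_assoc, add_assoc]

theorem inversionParity_mul (cs : CoxeterSystem M W) (x y t : W) :
    cs.inversionParity (x * y) t =
      cs.inversionParity y t + cs.inversionParity x (y * t * y⁻¹) := by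
  rw [inversionParity, map_mul, functionEnd_mul_apply,
    lift_signedConj_apply, lift_signedConj_apply, zero_add]

theorem inversionParity_one (cs : CoxeterSystem M W) (t : W) :
    cs.inversionParity 1 t = 0 := by
  simp [inversionParity, Function.End.one_def]

open scoped Classical in
theorem inversionParity_simple (cs : CoxeterSystem M W) (i : B) (t : W) :
    cs.inversionParity (cs.simple i) t = if t = cs.simple i then 1 else 0 := by
  simp [inversionParity, signedConj]

theorem mem_rightInvSeq_of_inversionParity_ne_zero (cs : CoxeterSystem M W) {ω : List B}
    {t : W} (h : cs.inversionParity (cs.wordProd ω) t ≠ 0) : t ∈ cs.rightInvSeq ω := by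
  classical
  induction ω with
  | nil => simp [inversionParity_one] at h
  | cons i ω ih =>
    rw [rightInvSeq, List.mem_cons]
    by_contra! hne
    refine h ?_
    rw [wordProd_cons, inversionParity_mul, not_not.mp (mt ih hne.2), inversionParity_simple,
      if_neg, add_zero]
    intro heq
    exact hne.1 (by rw [← heq]; group)

theorem isRightDescent_of_inversionParity_ne_zero (cs : CoxeterSystem M W) {w : W} {i : B}
    (h : cs.inversionParity w (cs.simple i) ≠ 0) : cs.IsRightDescent w i := by
  obtain ⟨ω, hω, rfl⟩ := cs.exists_isReduced w
  exact (cs.isRightInversion_of_mem_rightInvSeq hω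
    (cs.mem_rightInvSeq_of_inversionParity_ne_zero h)).2

theorem isRightDescent_iff_inversionParity_ne_zero (cs : CoxeterSystem M W) {w : W}
    {i : B} : cs.IsRightDescent w i ↔ cs.inversionParity w (cs.simple i) ≠ 0 := by
  refine ⟨fun h h0 ↦ ?_, cs.isRightDescent_of_inversionParity_ne_zero⟩
  refine cs.isRightDescent_iff_not_isRightDescent_mul.mp h
    (cs.isRightDescent_of_inversionParity_ne_zero ?_)
  rw [inversionParity_mul, inversionParity_simple]
  simp [h0]

/-- Right multiplication by an element of `W_J` does not change whether `s k` is a right descent,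
when `s k` commutes with `W_J`. -/
theorem isRightDescent_mul_iff_of_mem_closure (cs : CoxeterSystem M W) {J : Set B} {k : B}
    (hk : k ∉ J) (hcomm : ∀ j ∈ J, M k j = 2) {u : W}
    (hu : u ∈ Subgroup.closure (cs.simple '' J)) (w : W) :
    cs.IsRightDescent (w * u) k ↔ cs.IsRightDescent w k := by
  induction hu using Subgroup.closure_induction generalizing w with
  | mem x hx =>
    obtain ⟨j, hj, rfl⟩ := hx
    have hkj : cs.simple k ≠ cs.simple j := fun h ↦ hk (cs.simple_injective h ▸ hj)
    rw [isRightDescent_iff_inversionParity_ne_zero, isRightDescent_iff_inversionParity_ne_zero,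
      inversionParity_mul, inversionParity_simple, if_neg hkj, zero_add,
      ← (cs.commute_simple (hcomm j hj)).eq, mul_inv_cancel_right]
  | one => rw [mul_one]
  | mul x y _ _ hx hy => rw [← mul_assoc, hy, hx]
  | inv x _ hx => rw [← hx (w * x⁻¹), inv_mul_cancel_right]

theorem commute_simple_of_mem_closure (cs : CoxeterSystem M W) {J : Set B} {k : B}
    (hcomm : ∀ j ∈ J, M k j = 2) {u : W} (hu : u ∈ Subgroup.closure (cs.simple '' J)) :
    Commute (cs.simple k) u := by
  induction hu using Subgroup.closure_induction with
  | mem x hx =>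
    obtain ⟨j, hj, rfl⟩ := hx
    exact cs.commute_simple (hcomm j hj)
  | one => exact Commute.one_right _
  | mul x y _ _ hx hy => exact hx.mul_right hy
  | inv x _ hx => exact hx.inv_right

end CoxeterSystem


/-- The length-decreasing Hecke operator `w ↦ w_k`: `w_k = w s_k` if `ℓ(w s_k) < ℓ(w)`,
and `w_k = w` otherwise. -/
noncomputable def heckeDown {B W : Type*} [Group W] {M : CoxeterMatrix B}
    (cs : CoxeterSystem M W) (k : B) (w : W) : W :=
  if cs.length (w * cs.simple k) < cs.length w then w * cs.simple k else w

/-- The length-increasing Hecke operator `w ↦ w^k`: `w^k = w s_k` if `ℓ(w s_k) > ℓ(w)`,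
and `w^k = w` otherwise. -/
noncomputable def heckeUp {B W : Type*} [Group W] {M : CoxeterMatrix B}
    (cs : CoxeterSystem M W) (k : B) (w : W) : W :=
  if cs.length w < cs.length (w * cs.simple k) then w * cs.simple k else w

/-- `w` is a minimal-length coset representative for `W/W_J`:
`ℓ(w u) ≥ ℓ(w)` for every `u` in the standard parabolic subgroup `W_J`. -/
def IsMinimalRep {B W : Type*} [Group W] {M : CoxeterMatrix B}
    (cs : CoxeterSystem M W) (J : Set B) (w : W) : Prop :=
  ∀ u ∈ Subgroup.closure (cs.simple '' J), cs.length w ≤ cs.length (w * u)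

/-- Lemma 2.2 (Coxeter-theoretic form): if `k ∈ S \ J` and `s_k` commutes with `s_j` for all
`j ∈ J` (Coxeter matrix entry `M k j = 2`), and `w` is a minimal-length coset representative
for `W/W_J`, then so is `w s_k`; consequently so are `w_k` and `w^k`. -/
theorem minimalRep_mul_simple_of_kFree {B W : Type*} [Group W] {M : CoxeterMatrix B}
    (cs : CoxeterSystem M W) (J : Set B) (k : B) (hk : k ∉ J)
    (hcomm : ∀ j ∈ J, M k j = 2)
    (w : W) (hw : IsMinimalRep cs J w) :
    IsMinimalRep cs J (w * cs.simple k) ∧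
      IsMinimalRep cs J (heckeDown cs k w) ∧
      IsMinimalRep cs J (heckeUp cs k w) := by
  have hmul : IsMinimalRep cs J (w * cs.simple k) := by
    intro u hu
    have hle := hw u hu
    have hdesc := cs.isRightDescent_mul_iff_of_mem_closure hk hcomm hu w
    rw [mul_assoc, (cs.commute_simple_of_mem_closure hcomm hu).eq, ← mul_assoc]
    unfold CoxeterSystem.IsRightDescent at hdesc
    have h1 := cs.length_mul_simple w k
    have h2 := cs.length_mul_simple (w * u) k
    omega
  refine ⟨hmul, ?_, ?_⟩
  · unfold heckeDown
    split_ifs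
    exacts [hmul, hw]
  · unfold heckeUp
    split_ifs
    exacts [hmul, hw]
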